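/- In the polynomial ring over ℂ whose variables X_{ij} are indexed by the diagonals of the heptagon (the 7-gon with vertices 1,…,7), the following identity holds: ∂³Adj_4/(∂X_{27}∂X_{37}∂X_{47}) = X_{57}·Adj_3 + X_{16}·X_{26}·X_{36}·X_{46}·Adj_2, where Adj_4 is the universal adjoint of the heptagon, Adj_3 is the universal adjoint of the hexagon on vertices 1,…,6, and Adj_2 is the universal adjoint of the pentagon on vertices 1,…,5, the latter two regarded as elements of the heptagon's polynomial ring via the inclusion of diagonals. -/

import Mathlib

/-- `(i, j)` is a diagonal of the convex `m`-gon with vertices `1, …, m`: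
`1 ≤ i < j ≤ m`, `j - i ≥ 2`, and `(i, j) ≠ (1, m)`. -/
def IsDiag (m : ℕ) (p : ℕ × ℕ) : Prop :=
  1 ≤ p.1 ∧ p.1 + 2 ≤ p.2 ∧ p.2 ≤ m ∧ ¬(p.1 = 1 ∧ p.2 = m)

/-- Two diagonals `(i,j)` and `(k,l)` cross if `i < k < j < l` or `k < i < l < j`. -/
def Crossing (p q : ℕ × ℕ) : Prop :=
  (p.1 < q.1 ∧ q.1 < p.2 ∧ p.2 < q.2) ∨ (q.1 < p.1 ∧ p.1 < q.2 ∧ q.2 < p.2)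

open scoped Classical in
/-- The finite set of diagonals of the `m`-gon. -/
noncomputable def diagonals (m : ℕ) : Finset (ℕ × ℕ) :=
  (Finset.range (m + 1) ×ˢ Finset.range (m + 1)).filter (IsDiag m)

/-- A triangulation of the `m`-gon: a set of `m - 3` pairwise non-crossing diagonals. -/
def IsTriangulation (m : ℕ) (T : Finset (ℕ × ℕ)) : Prop :=
  T.card = m - 3 ∧ (∀ p ∈ T, IsDiag m p) ∧ ∀ p ∈ T, ∀ q ∈ T, ¬ Crossing p q

open scoped Classical in
/-- The finite set of all triangulations of the `m`-gon. -/
noncomputable def triangulations (m : ℕ) : Finset (Finset (ℕ × ℕ)) :=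
  (diagonals m).powerset.filter (IsTriangulation m)

/-- The universal adjoint `Adj_{m-3} = Σ_T Π_{(i,j) ∉ T} X_{ij}` of the
`(m-3)`-dimensional ABHY associahedron, as an element of the polynomial ring over `ℂ`
with one variable `X (i, j)` for each pair `(i, j)`; only the variables indexed by
diagonals of the `m`-gon occur, and polynomial rings on fewer vertices are included in
those on more vertices via the inclusion of diagonals. -/
noncomputable def Adj (m : ℕ) : MvPolynomial (ℕ × ℕ) ℂ :=
  ∑ T ∈ triangulations m, ∏ d ∈ diagonals m \ T, MvPolynomial.X d

/-- `Adj_{m-3}` admits an AV-representation: there are a triangulation `T` of the `m`-gon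
and a square matrix `A`, indexed by the diagonals of the `m`-gon not in `T`, with entries
in `ℂ[X_{ij} : (i,j) ∈ T]`, such that `Adj_{m-3} = det(diag(X_{ij} : (i,j) ∉ T) + A)`. -/
def HasAVRep (m : ℕ) : Prop :=
  ∃ T : Finset (ℕ × ℕ), IsTriangulation m T ∧
    ∃ A : Matrix {d // d ∈ diagonals m \ T} {d // d ∈ diagonals m \ T}
        (MvPolynomial (ℕ × ℕ) ℂ),
      (∀ i j, A i j ∈ MvPolynomial.supported ℂ (↑T : Set (ℕ × ℕ))) ∧
      Adj m = (Matrix.diagonal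
          (fun d : {d // d ∈ diagonals m \ T} => MvPolynomial.X d.val) + A).det

open MvPolynomial Finset

instance (m : ℕ) : DecidablePred (IsDiag m) := fun _ => by
  unfold IsDiag; infer_instance

instance : DecidableRel Crossing := fun _ _ => by
  unfold Crossing; infer_instance

/-- A computable version of `diagonals`. -/
def diagonalFinset (m : ℕ) : Finset (ℕ × ℕ) :=
  (range (m + 1) ×ˢ range (m + 1)).filter (IsDiag m)

theorem diagonals_eq_diagonalFinset (m : ℕ) : diagonals m = diagonalFinset m := by
  ext; simp [diagonals, diagonalFinset]

theorem mem_diagonals {m : ℕ} {p : ℕ × ℕ} : p ∈ diagonals m ↔ IsDiag m p := by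
  simp only [diagonals, IsDiag, mem_filter, mem_product, mem_range]
  omega

/-- The sets of diagonals which are complements of triangulations of the `m`-gon. -/
def triangulationComplements (m : ℕ) : Finset (Finset (ℕ × ℕ)) :=
  ((powersetCard (m - 3) (diagonalFinset m)).filter
    fun T => ∀ p ∈ T, ∀ q ∈ T, ¬ Crossing p q).image (diagonalFinset m \ ·)

theorem triangulations_eq_filter_powersetCard (m : ℕ) :
    triangulations m = (powersetCard (m - 3) (diagonalFinset m)).filter
      fun T => ∀ p ∈ T, ∀ q ∈ T, ¬ Crossing p q := by
  ext T
  simp only [triangulations, IsTriangulation, mem_filter, mem_powerset, mem_powersetCard,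
    ← diagonals_eq_diagonalFinset, subset_iff, mem_diagonals]
  tauto

/-- The sum of the squarefree monomials with supports in `𝒮`. -/
noncomputable def squarefreeSum {σ : Type*} (𝒮 : Finset (Finset σ)) : MvPolynomial σ ℂ :=
  ∑ S ∈ 𝒮, ∏ d ∈ S, X d

theorem Adj_eq_squarefreeSum (m : ℕ) :
    Adj m = squarefreeSum (triangulationComplements m) := by
  rw [Adj, squarefreeSum, triangulationComplements, sum_image,
    triangulations_eq_filter_powersetCard, diagonals_eq_diagonalFinset]
  intro S hS T hT h
  have hS' := (mem_powersetCard.1 (mem_filter.1 hS).1).1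
  have hT' := (mem_powersetCard.1 (mem_filter.1 hT).1).1
  rw [← Finset.sdiff_sdiff_eq_self hS', ← Finset.sdiff_sdiff_eq_self hT']
  exact congrArg (diagonalFinset m \ ·) h

section SquarefreeSum

variable {σ : Type*} [DecidableEq σ]

theorem pderiv_prod_X (d : σ) (S : Finset σ) :
    pderiv d (∏ e ∈ S, X e : MvPolynomial σ ℂ) =
      if d ∈ S then ∏ e ∈ S.erase d, X e else 0 := by
  have hzero : ∀ T : Finset σ, d ∉ T → pderiv d (∏ e ∈ T, X e : MvPolynomial σ ℂ) = 0 := by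
    intro T hT
    refine pderiv_eq_zero_of_notMem_vars fun h => ?_
    obtain ⟨e, he, hde⟩ := mem_biUnion.1 (vars_prod _ h)
    rw [vars_X, mem_singleton] at hde
    exact hT (hde ▸ he)
  split_ifs with h
  · rw [← mul_prod_erase S _ h, pderiv_mul, hzero _ (notMem_erase d S), pderiv_X_self]
    simp
  · exact hzero S h

theorem pderiv_squarefreeSum (d : σ) (𝒮 : Finset (Finset σ)) :
    pderiv d (squarefreeSum 𝒮) =
      squarefreeSum ((𝒮.filter (d ∈ ·)).image (·.erase d)) := by
  rw [squarefreeSum, squarefreeSum, map_sum, sum_image, sum_filter]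
  · exact sum_congr rfl fun S _ => pderiv_prod_X d S
  · intro S hS T hT h
    rw [← insert_erase (mem_filter.1 hS).2, ← insert_erase (mem_filter.1 hT).2]
    exact congrArg (insert d) h

theorem prod_X_mul_squarefreeSum (U : Finset σ) (𝒮 : Finset (Finset σ))
    (h : ∀ S ∈ 𝒮, Disjoint U S) :
    (∏ d ∈ U, X d) * squarefreeSum 𝒮 = squarefreeSum (𝒮.image (U ∪ ·)) := by
  rw [squarefreeSum, squarefreeSum, mul_sum, sum_image]
  · refine sum_congr rfl fun S hS => ?_
    rw [prod_union (h S hS)]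
  · intro S hS T hT hST
    rw [← union_sdiff_cancel_left (h S hS), ← union_sdiff_cancel_left (h T hT)]
    exact congrArg (· \ U) hST

theorem squarefreeSum_union {𝒮 𝒯 : Finset (Finset σ)} (h : Disjoint 𝒮 𝒯) :
    squarefreeSum (𝒮 ∪ 𝒯) = squarefreeSum 𝒮 + squarefreeSum 𝒯 :=
  sum_union h

end SquarefreeSum

/-- `∂³Adj₄/(∂X₂₇∂X₃₇∂X₄₇) = X₅₇·Adj₃ + X₁₆·X₂₆·X₃₆·X₄₆·Adj₂`, where `Adj₄ = Adj 7`,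
`Adj₃ = Adj 6` and `Adj₂ = Adj 5` live in the common polynomial ring with variables
indexed by pairs. -/
theorem stmt_17 :
    MvPolynomial.pderiv (2, 7) (MvPolynomial.pderiv (3, 7)
        (MvPolynomial.pderiv (4, 7) (Adj 7))) =
      MvPolynomial.X (5, 7) * Adj 6 +
        MvPolynomial.X (1, 6) * MvPolynomial.X (2, 6) * MvPolynomial.X (3, 6) *
          MvPolynomial.X (4, 6) * Adj 5 := by
  have hX : (X (1, 6) * X (2, 6) * X (3, 6) * X (4, 6) : MvPolynomial (ℕ × ℕ) ℂ) =
      ∏ d ∈ {(1, 6), (2, 6), (3, 6), (4, 6)}, X d := by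
    simp [mul_assoc]
  rw [hX, ← prod_singleton (X : ℕ × ℕ → MvPolynomial (ℕ × ℕ) ℂ) (5, 7)]
  simp only [Adj_eq_squarefreeSum, pderiv_squarefreeSum]
  rw [prod_X_mul_squarefreeSum _ _ (by decide +kernel),
    prod_X_mul_squarefreeSum _ _ (by decide +kernel),
    ← squarefreeSum_union (by decide +kernel)]
  congr 1
  decide +kernel
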